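/- Define, for positive reals t, ω₀, ω₁, ω₂, the quantities A = ω₁ − ω₂·t + ω₀·t², B = ω₂ − ω₀·t + ω₁·t², C = ω₀ − ω₁·t + ω₂·t². Then the set { (t, e, ω₀, ω₁, ω₂) ∈ (0,∞)⁵ : A > 0, B > 0, and C > 0 } is a nonempty open subset of (0,∞)⁵ which, with its subspace topology, is homeomorphic to ℝ⁵. -/

import Mathlib

/-- `A = ω₁ − ω₂·t + ω₀·t²`. -/
def quantA (t w0 w1 w2 : ℝ) : ℝ := w1 - w2 * t + w0 * t ^ 2

/-- `B = ω₂ − ω₀·t + ω₁·t²`. -/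
def quantB (t w0 w1 w2 : ℝ) : ℝ := w2 - w0 * t + w1 * t ^ 2

/-- `C = ω₀ − ω₁·t + ω₂·t²`. -/
def quantC (t w0 w1 w2 : ℝ) : ℝ := w0 - w1 * t + w2 * t ^ 2

/-- The cell `{A > 0, B > 0, C > 0}` in `(0,∞)⁵`, coordinates `(t, e, ω₀, ω₁, ω₂)`. -/
def triangCell : Set (Fin 5 → ℝ) :=
  {x | (∀ i, 0 < x i) ∧
    0 < quantA (x 0) (x 2) (x 3) (x 4) ∧
    0 < quantB (x 0) (x 2) (x 3) (x 4) ∧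
    0 < quantC (x 0) (x 2) (x 3) (x 4)}

theorem continuous_quantA : Continuous fun x : Fin 5 → ℝ => quantA (x 0) (x 2) (x 3) (x 4) := by
  unfold quantA; fun_prop

theorem continuous_quantB : Continuous fun x : Fin 5 → ℝ => quantB (x 0) (x 2) (x 3) (x 4) := by
  unfold quantB; fun_prop

theorem continuous_quantC : Continuous fun x : Fin 5 → ℝ => quantC (x 0) (x 2) (x 3) (x 4) := by
  unfold quantC; fun_prop

/-- The linear map `(ω₀, ω₁, ω₂) ↦ (A, B, C)` is inverted by
`(1 + t³) ω₀ = C + t A`, `(1 + t³) ω₁ = A + t B`, `(1 + t³) ω₂ = B + t C`. -/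
noncomputable def cellPoint (t e A B C : ℝ) : Fin 5 → ℝ :=
  ![t, e, (C + t * A) / (1 + t ^ 3), (A + t * B) / (1 + t ^ 3), (B + t * C) / (1 + t ^ 3)]

section

variable {t e A B C : ℝ}

theorem quantA_cellPoint (ht : 0 < t) :
    quantA t ((C + t * A) / (1 + t ^ 3)) ((A + t * B) / (1 + t ^ 3))
      ((B + t * C) / (1 + t ^ 3)) = A := by
  unfold quantA; field_simp; ring

theorem quantB_cellPoint (ht : 0 < t) :
    quantB t ((C + t * A) / (1 + t ^ 3)) ((A + t * B) / (1 + t ^ 3))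
      ((B + t * C) / (1 + t ^ 3)) = B := by
  unfold quantB; field_simp; ring

theorem quantC_cellPoint (ht : 0 < t) :
    quantC t ((C + t * A) / (1 + t ^ 3)) ((A + t * B) / (1 + t ^ 3))
      ((B + t * C) / (1 + t ^ 3)) = C := by
  unfold quantC; field_simp; ring

theorem cellPoint_mem (ht : 0 < t) (he : 0 < e) (hA : 0 < A) (hB : 0 < B) (hC : 0 < C) :
    cellPoint t e A B C ∈ triangCell := by
  refine ⟨?_, ?_, ?_, ?_⟩
  · intro i
    fin_cases i <;> simp [cellPoint] <;> positivity
  · simpa [cellPoint, quantA_cellPoint ht] using hA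
  · simpa [cellPoint, quantB_cellPoint ht] using hB
  · simpa [cellPoint, quantC_cellPoint ht] using hC

end

theorem cellPoint_quant {x : Fin 5 → ℝ} (ht : 0 < x 0) :
    cellPoint (x 0) (x 1) (quantA (x 0) (x 2) (x 3) (x 4)) (quantB (x 0) (x 2) (x 3) (x 4))
      (quantC (x 0) (x 2) (x 3) (x 4)) = x := by
  ext i
  fin_cases i <;> simp [cellPoint, quantA, quantB, quantC] <;> field_simp <;> ring

/-- Logarithms of the coordinates `(t, e, A, B, C)` identify the cell with `ℝ⁵`. -/
noncomputable def triangCellHomeomorph : triangCell ≃ₜ (Fin 5 → ℝ) where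
  toFun x := ![Real.log (x.1 0), Real.log (x.1 1),
    Real.log (quantA (x.1 0) (x.1 2) (x.1 3) (x.1 4)),
    Real.log (quantB (x.1 0) (x.1 2) (x.1 3) (x.1 4)),
    Real.log (quantC (x.1 0) (x.1 2) (x.1 3) (x.1 4))]
  invFun y := ⟨cellPoint (Real.exp (y 0)) (Real.exp (y 1)) (Real.exp (y 2)) (Real.exp (y 3))
    (Real.exp (y 4)), cellPoint_mem (Real.exp_pos _) (Real.exp_pos _) (Real.exp_pos _)
      (Real.exp_pos _) (Real.exp_pos _)⟩
  left_inv x := by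
    obtain ⟨x, hx, hA, hB, hC⟩ := x
    apply Subtype.ext
    simpa [Real.exp_log, hx, hA, hB, hC] using cellPoint_quant (hx 0)
  right_inv y := by
    have h := Real.exp_pos (y 0)
    ext i
    fin_cases i <;>
      simp [cellPoint, quantA_cellPoint h, quantB_cellPoint h, quantC_cellPoint h]
  continuous_toFun := by
    refine continuous_pi fun i => ?_
    fin_cases i
    · exact ((continuous_apply 0).comp continuous_subtype_val).log fun x => (x.2.1 0).ne'
    · exact ((continuous_apply 1).comp continuous_subtype_val).log fun x => (x.2.1 1).ne'
    · exact (continuous_quantA.comp continuous_subtype_val).log fun x => x.2.2.1.ne'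
    · exact (continuous_quantB.comp continuous_subtype_val).log fun x => x.2.2.2.1.ne'
    · exact (continuous_quantC.comp continuous_subtype_val).log fun x => x.2.2.2.2.ne'
  continuous_invFun := by
    refine Continuous.subtype_mk (continuous_pi fun i => ?_) _
    have h (y : Fin 5 → ℝ) : 1 + Real.exp (y 0) ^ 3 ≠ 0 := by positivity
    fin_cases i <;> simp [cellPoint] <;> fun_prop (disch := exact h _)

theorem isOpen_triangCell : IsOpen triangCell := by
  have hpos : IsOpen {x : Fin 5 → ℝ | ∀ i, 0 < x i} := by
    simp only [Set.ofPred_forall]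
    exact isOpen_iInter_of_finite fun i => isOpen_lt continuous_const (continuous_apply i)
  exact hpos.inter ((isOpen_lt continuous_const continuous_quantA).inter
    ((isOpen_lt continuous_const continuous_quantB).inter
      (isOpen_lt continuous_const continuous_quantC)))

theorem stmt_11 :
    triangCell.Nonempty ∧ IsOpen triangCell ∧
    triangCell ⊆ {x : Fin 5 → ℝ | ∀ i, 0 < x i} ∧
    Nonempty (↥triangCell ≃ₜ (Fin 5 → ℝ)) :=
  ⟨⟨_, cellPoint_mem one_pos one_pos one_pos one_pos one_pos⟩, isOpen_triangCell,
    fun _ hx => hx.1, ⟨triangCellHomeomorph⟩⟩
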